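/- arXiv:2605.05262 — 2 statements merged into one kernel-verified Lean document; each statement's English description precedes it below -/
import Mathlib

section
/- Let α be a finite type and let F : Finset α → ℝ be a monotone submodular set function. Then for all finite sets S, T ⊆ α, F(S ∪ T) ≤ F(S) + ∑_{x ∈ T \ S} (F(insert x S) − F(S)). In particular, if F(∅) = 0 and OPT = F(S*) for any S*, then F(S*) ≤ F(S) + ∑_{x ∈ S* \ S} (F(insert x S) − F(S)). -/
/-- A set function on finite subsets of `α` is submodular if marginal gains are
diminishing. -/
def Submodular {α : Type*} [DecidableEq α] (F : Finset α → ℝ) : Prop :=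
  ∀ S T : Finset α, S ⊆ T → ∀ x ∉ T, F (insert x T) - F T ≤ F (insert x S) - F S

/-- The gain of adding a set `U` disjoint from `S` is at most the sum of the singleton gains. -/
theorem Submodular.union_le_add_sum {α : Type*} [DecidableEq α] {F : Finset α → ℝ}
    (hF : Submodular F) {S U : Finset α} (hSU : Disjoint S U) :
    F (S ∪ U) ≤ F S + ∑ x ∈ U, (F (insert x S) - F S) := by
  induction U using Finset.induction_on with
  | empty => simp
  | insert a U ha ih =>
    rw [Finset.disjoint_insert_right] at hSU
    have hgain := hF S (S ∪ U) Finset.subset_union_left a (by simp [hSU.1, ha])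
    rw [Finset.union_insert, Finset.sum_insert ha]
    linarith [ih hSU.2]

/-- **Telescoping marginal-gain bound for monotone submodular functions.**
For a monotone submodular `F`, `F (S ∪ T) ≤ F S + ∑_{x ∈ T \ S} (F (insert x S) - F S)`;
in particular, if `F ∅ = 0` then for any `S*`,
`F S* ≤ F S + ∑_{x ∈ S* \ S} (F (insert x S) - F S)`. -/
theorem submodular_telescoping (α : Type*) [Fintype α] [DecidableEq α]
    (F : Finset α → ℝ) (hmono : Monotone F) (hsub : Submodular F) :
    (∀ S T : Finset α,
        F (S ∪ T) ≤ F S + ∑ x ∈ T \ S, (F (insert x S) - F S)) ∧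
    (F ∅ = 0 → ∀ Sstar S : Finset α,
        F Sstar ≤ F S + ∑ x ∈ Sstar \ S, (F (insert x S) - F S)) := by
  have hunion (S T : Finset α) :
      F (S ∪ T) ≤ F S + ∑ x ∈ T \ S, (F (insert x S) - F S) := by
    simpa using hsub.union_le_add_sum (Finset.disjoint_sdiff (s := S) (t := T))
  exact ⟨hunion, fun _ Sstar S => (hmono Finset.subset_union_right).trans (hunion S Sstar)⟩
end

section
/- Let α be a finite type, let F : Finset α → ℝ be a monotone submodular set function with F(∅) = 0, let k ≥ 1 be an integer, and let OPT = max over all S ⊆ α with |S| ≤ k of F(S). Suppose (G_i) is a greedy sequence: G_0 = ∅ and G_{i+1} = insert x_i G_i where x_i maximizes the marginal gain F(insert x G_i) − F(G_i) over all x ∈ α. Then for every i, OPT − F(G_{i+1}) ≤ (1 − 1/k) · (OPT − F(G_i)). -/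
/-- For a submodular function, the gain of adding a set is at most the sum of the gains of
adding its elements individually. -/
theorem Submodular.union_sub_le_sum {α : Type*} [DecidableEq α] {F : Finset α → ℝ}
    (hF : Submodular F) (A S : Finset α) :
    F (A ∪ S) - F A ≤ ∑ x ∈ S, (F (insert x A) - F A) := by
  induction S using Finset.induction_on with
  | empty => simp
  | insert x S hx ih =>
    rw [Finset.sum_insert hx, Finset.union_insert]
    by_cases hxA : x ∈ A
    · rw [Finset.insert_eq_of_mem (Finset.mem_union_left S hxA), Finset.insert_eq_of_mem hxA]
      linarith
    · have := hF A (A ∪ S) Finset.subset_union_left x (by simp [hxA, hx])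
      linarith

/-- If every element has marginal gain at most `g` over `A`, where `0 ≤ g`, then the value of any
set of at most `k` elements exceeds that of `A` by at most `k * g`. -/
theorem Submodular.sub_le_mul_of_card_le {α : Type*} [DecidableEq α] {F : Finset α → ℝ}
    (hF : Submodular F) (hmono : Monotone F) {A S : Finset α} {k : ℕ} (hS : S.card ≤ k)
    {g : ℝ} (hg : 0 ≤ g) (hgain : ∀ y, F (insert y A) - F A ≤ g) :
    F S - F A ≤ k * g :=
  calc
    F S - F A ≤ F (A ∪ S) - F A := sub_le_sub_right (hmono Finset.subset_union_right) _
    _ ≤ ∑ x ∈ S, (F (insert x A) - F A) := hF.union_sub_le_sum A S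
    _ ≤ S.card * g := by
      simpa only [nsmul_eq_mul] using Finset.sum_le_card_nsmul S _ g fun y _ => hgain y
    _ ≤ k * g := by gcongr

/-- **Per-step greedy recursion (Nemhauser–Wolsey–Fisher).**
For a monotone submodular `F` with `F ∅ = 0`, if `OPT` is the maximum of `F` over
sets of cardinality at most `k` and `(G i)` is a greedy sequence (each step inserting
an element of maximal marginal gain), then
`OPT - F (G (i+1)) ≤ (1 - 1/k) · (OPT - F (G i))` for every `i`. -/
theorem greedy_step_recursion (α : Type*) [Fintype α] [DecidableEq α]
    (F : Finset α → ℝ) (hmono : Monotone F) (hsub : Submodular F) (hF0 : F ∅ = 0)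
    (k : ℕ) (hk : 1 ≤ k) (OPT : ℝ)
    (hOPT_ub : ∀ S : Finset α, S.card ≤ k → F S ≤ OPT)
    (hOPT_mem : ∃ S : Finset α, S.card ≤ k ∧ F S = OPT)
    (G : ℕ → Finset α) (hG0 : G 0 = ∅)
    (hGstep : ∀ i, ∃ x, G (i + 1) = insert x (G i) ∧
      ∀ y, F (insert y (G i)) - F (G i) ≤ F (insert x (G i)) - F (G i)) :
    ∀ i, OPT - F (G (i + 1)) ≤ (1 - 1 / (k : ℝ)) * (OPT - F (G i)) := by
  intro i
  obtain ⟨S, hS, rfl⟩ := hOPT_mem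
  obtain ⟨x, hx, hmax⟩ := hGstep i
  have hk0 : (0 : ℝ) < k := by exact_mod_cast hk
  have hgap := hsub.sub_le_mul_of_card_le hmono hS
    (sub_nonneg.2 (hmono (Finset.subset_insert x (G i)))) hmax
  have hdiv := (div_le_iff₀' hk0).2 hgap
  rw [hx, sub_mul, one_mul, one_div_mul_eq_div]
  linarith
end
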